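/- Let k: ℤ → [0,∞) be a nontrivial kernel with k(0)=0, k(−j)=k(j) for all j ∈ ℤ and |k|₁ := ∑_{j∈ℤ} k(j) < ∞. Suppose there exists τ ∈ (0,1) such that ∑_{j∈ℤ} k(j)^{1−τ} < ∞ (with terms for k(j)=0 interpreted as 0). Then there exist constants c₁, c₂ > 0 and a strictly convex CD-function F such that the operator L generated by k satisfies CD_Υ(0,F), F(r)/(c₁ e^{r/|k|₁}) → 1 as r → ∞, and F(r)/(c₂ r^{(1+τ)/τ}) → 1 as r → 0+. -/

import Mathlib

open scoped BigOperators
open Filter Set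

noncomputable section

/-- `Υ(r) = e^r − 1 − r`. -/
def Ups (r : ℝ) : ℝ := Real.exp r - 1 - r

/-- `H(x) = (1/2) e^{−x} Υ(2x)`. -/
def Hfun (x : ℝ) : ℝ := (1 / 2) * Real.exp (-x) * Ups (2 * x)

/-- The long-range jump operator `L u (x) = ∑_{j∈ℤ} k(j)(u(x+j) − u(x))`. -/
def Lop (k : ℤ → ℝ) (u : ℤ → ℝ) (x : ℤ) : ℝ := ∑' j : ℤ, k j * (u (x + j) - u x)

/-- `Ψ_Υ(u)(x) = ∑_{j∈ℤ} k(j) Υ(u(x+j) − u(x))`. -/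
def PsiUps (k : ℤ → ℝ) (u : ℤ → ℝ) (x : ℤ) : ℝ := ∑' j : ℤ, k j * Ups (u (x + j) - u x)

/-- `Ψ_{2,Υ}(u)(x)`. -/
def Psi2 (k : ℤ → ℝ) (u : ℤ → ℝ) (x : ℤ) : ℝ :=
  (1 / 2) * ∑' p : ℤ × ℤ, k p.1 * k p.2 * Real.exp (u (x + p.2) - u x) *
    Ups (u (x + p.1 + p.2) - u (x + p.1) - u (x + p.2) + u x)

/-- A bounded function on `ℤ`. -/
def BddFun (u : ℤ → ℝ) : Prop := ∃ M : ℝ, ∀ x : ℤ, |u x| ≤ M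

/-- A nontrivial symmetric integrable kernel on `ℤ` vanishing at `0`. -/
structure IsKernel (k : ℤ → ℝ) : Prop where
  nonneg : ∀ j, 0 ≤ k j
  zero_at_zero : k 0 = 0
  symm : ∀ j, k (-j) = k j
  summable : Summable k
  nontrivial : ∃ j, k j ≠ 0

/-- A CD-function: continuous on `[0,∞)`, nonnegative, `F(0)=0`, `r ↦ F(r)/r` strictly
increasing on `(0,∞)` and `1/F` integrable at `∞`. -/
def IsCDFunction (F : ℝ → ℝ) : Prop :=
  ContinuousOn F (Ici 0) ∧ (∀ r, 0 ≤ r → 0 ≤ F r) ∧ F 0 = 0 ∧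
    StrictMonoOn (fun r => F r / r) (Ioi 0) ∧
    ∃ a, 0 < a ∧ MeasureTheory.IntegrableOn (fun r => 1 / F r) (Ici a)

/-- The curvature-dimension condition `CD_Υ(0,F)` for the operator generated by `k`. -/
def CDUps (k : ℤ → ℝ) (F : ℝ → ℝ) : Prop :=
  ∀ u : ℤ → ℝ, BddFun u → ∀ x : ℤ, 0 ≤ -Lop k u x → F (-Lop k u x) ≤ Psi2 k u x

lemma Ups_nonneg (r : ℝ) : 0 ≤ Ups r := by
  unfold Ups; linarith [Real.add_one_le_exp r]

lemma Ups_sq {r : ℝ} (hr : 0 ≤ r) : r ^ 2 / 2 ≤ Ups r := by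
  unfold Ups; linarith [Real.quadratic_le_exp_of_nonneg hr]

lemma Hfun_nonneg (x : ℝ) : 0 ≤ Hfun x := by
  unfold Hfun
  have := Ups_nonneg (2 * x)
  positivity

lemma Hfun_exp (x : ℝ) : Real.exp x / 2 - 3 / 2 ≤ Hfun x := by
  rcases le_or_gt x 0 with h | h
  · have := Hfun_nonneg x
    have := Real.exp_le_one_iff.2 h
    linarith
  · have e : Hfun x = (Real.exp x - Real.exp (-x) * (1 + 2 * x)) / 2 := by
      have h1 : Real.exp (2 * x) = Real.exp x * Real.exp x := by
        rw [← Real.exp_add]; ring_nf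
      have h2 : Real.exp (-x) * Real.exp x = 1 := by
        rw [← Real.exp_add]; simp
      unfold Hfun Ups
      rw [h1]
      linear_combination (Real.exp x / 2) * h2
    have h3 : Real.exp (-x) * (1 + 2 * x) ≤ 3 := by
      have h2 : Real.exp (-x) * Real.exp x = 1 := by
        rw [← Real.exp_add]; simp
      have := Real.add_one_le_exp x
      have h4 : 1 + 2 * x ≤ 3 * Real.exp x := by linarith
      nlinarith [Real.exp_pos (-x)]
    rw [e]; linarith

lemma Hfun_pow {p : ℝ} (hp : 2 ≤ p) : ∃ a : ℝ, 0 < a ∧ ∀ x, 0 ≤ x → a * x ^ p ≤ Hfun x := by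
  have hp0 : 0 < p := by linarith
  have hpp : 0 < p ^ p := Real.rpow_pos_of_pos hp0 p
  have h2p : (0:ℝ) < 2 ^ (p - 2) := Real.rpow_pos_of_pos (by norm_num) _
  refine ⟨min (Real.exp (-2) / 2 ^ (p - 2)) (1 / (4 * p ^ p)), by positivity, fun x hx => ?_⟩
  have hxp : 0 ≤ x ^ p := Real.rpow_nonneg hx p
  rcases le_or_gt x 2 with h | h
  · have h1 : x ^ p ≤ 2 ^ (p - 2) * x ^ 2 := by
      have : x ^ p = x ^ (p - 2) * x ^ 2 := by
        rw [← Real.rpow_natCast x 2, ← Real.rpow_add_of_nonneg hx (by linarith) (by norm_num)]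
        norm_num
      rw [this]
      gcongr
    have h2 : Real.exp (-2) * x ^ 2 ≤ Hfun x := by
      unfold Hfun
      have h3 := Ups_sq (r := 2 * x) (by linarith)
      have h4 : Real.exp (-2) ≤ Real.exp (-x) := Real.exp_le_exp.2 (by linarith)
      calc Real.exp (-2) * x ^ 2 ≤ Real.exp (-x) * x ^ 2 := by gcongr
        _ = (1/2) * Real.exp (-x) * ((2 * x) ^ 2 / 2) := by ring
        _ ≤ _ := by gcongr
    calc _ ≤ Real.exp (-2) / 2 ^ (p - 2) * x ^ p := by gcongr; exact min_le_left _ _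
      _ ≤ Real.exp (-2) / 2 ^ (p - 2) * (2 ^ (p - 2) * x ^ 2) := by gcongr
      _ = Real.exp (-2) * x ^ 2 := by field_simp
      _ ≤ _ := h2
  · have h1 : x ^ p ≤ p ^ p * Real.exp x := by
      have : x ≤ p * Real.exp (x / p) := by
        have := Real.add_one_le_exp (x / p)
        have h3 : x / p ≤ Real.exp (x / p) := by linarith
        rw [div_le_iff₀ hp0] at h3
        linarith
      calc x ^ p ≤ (p * Real.exp (x / p)) ^ p := by gcongr
        _ = p ^ p * Real.exp x := by
          rw [Real.mul_rpow hp0.le (Real.exp_pos _).le, ← Real.exp_mul]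
          congr 2; field_simp
    have h2 : Real.exp x / 4 ≤ Hfun x := by
      have := Hfun_exp x
      have h6 : 6 ≤ Real.exp x := by
        have h7 := Real.exp_one_gt_d9
        have h8 : Real.exp 2 = Real.exp 1 * Real.exp 1 := by rw [← Real.exp_add]; norm_num
        have h9 : Real.exp 2 ≤ Real.exp x := Real.exp_le_exp.2 h.le
        nlinarith
      linarith
    calc _ ≤ 1 / (4 * p ^ p) * x ^ p := by gcongr; exact min_le_right _ _
      _ ≤ 1 / (4 * p ^ p) * (p ^ p * Real.exp x) := by gcongr
      _ = Real.exp x / 4 := by field_simp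
      _ ≤ _ := h2

/-- linear lower bound principle -/
lemma Psi2_lower (k : ℤ → ℝ) (hk : IsKernel k) (s : ℝ)
    (hsum : Summable fun j : ℤ => k j ^ s) (A B D : ℝ)
    (H : ∀ j w, A * (k j * w) - B * k j - D * k j ^ s ≤ k j ^ 2 * Hfun w)
    (u : ℤ → ℝ) (hu : BddFun u) (x : ℤ) :
    A * (-Lop k u x) - B * (∑' j, k j) - D * (∑' j, k j ^ s) ≤ Psi2 k u x := by
  obtain ⟨M, hM⟩ := hu
  have hM' := fun y => abs_le.1 (hM y)
  set T : ℤ × ℤ → ℝ := fun p => k p.1 * k p.2 * Real.exp (u (x + p.2) - u x) *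
    Ups (u (x + p.1 + p.2) - u (x + p.1) - u (x + p.2) + u x) with hT
  have hT0 : ∀ p, 0 ≤ T p := fun p => by
    have := hk.nonneg p.1
    have := hk.nonneg p.2
    have := Ups_nonneg (u (x + p.1 + p.2) - u (x + p.1) - u (x + p.2) + u x)
    simp only [hT]; positivity
  have hTs : Summable T := by
    have h1 : Summable fun p : ℤ × ℤ => k p.1 * k p.2 :=
      hk.summable.mul_of_nonneg hk.summable hk.nonneg hk.nonneg
    refine Summable.of_nonneg_of_le hT0 (fun p => ?_)
      (h1.mul_right (Real.exp (2 * M) * (Real.exp (4 * M) + 4 * M)))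
    have a1 := hM' (x + p.2)
    have a2 := hM' x
    have a3 := hM' (x + p.1)
    have a4 := hM' (x + p.1 + p.2)
    have b1 : Real.exp (u (x + p.2) - u x) ≤ Real.exp (2 * M) := Real.exp_le_exp.2 (by linarith)
    have b2 : Ups (u (x + p.1 + p.2) - u (x + p.1) - u (x + p.2) + u x)
        ≤ Real.exp (4 * M) + 4 * M := by
      have : Real.exp (u (x + p.1 + p.2) - u (x + p.1) - u (x + p.2) + u x) ≤ Real.exp (4 * M) :=
        Real.exp_le_exp.2 (by linarith)
      unfold Ups; linarith
    have := hk.nonneg p.1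
    have := hk.nonneg p.2
    simp only [hT]
    rw [mul_assoc (k p.1 * k p.2)]
    gcongr
    exact Ups_nonneg _
  set i : ℤ → ℤ × ℤ := fun j => (j, -j) with hi
  have hinj : Function.Injective i := fun a b h => (Prod.mk.inj h).1
  have hfs : Summable (T ∘ i) := hTs.comp_injective hinj
  have hle : ∑' j, T (i j) ≤ ∑' p, T p :=
    hfs.tsum_le_tsum_of_inj i hinj (fun c _ => hT0 c) (fun j => le_rfl) hTs
  have hneg : ∑' j, T (i (-j)) = ∑' j, T (i j) := (Equiv.neg ℤ).tsum_eq (fun j => T (i j))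
  have hfsn : Summable fun j => T (i (-j)) := (Equiv.neg ℤ).summable_iff.2 hfs
  -- the Laplacian
  have hLs : Summable fun j => k j * (u (x + j) - u x) := by
    refine Summable.of_norm_bounded (hk.summable.mul_right (2 * M)) (fun j => ?_)
    rw [Real.norm_eq_abs, abs_mul, abs_of_nonneg (hk.nonneg j)]
    have := hk.nonneg j
    gcongr
    have a1 := hM' (x + j)
    have a2 := hM' x
    rw [abs_le]; constructor <;> linarith
  have hLsn : Summable fun j => k (-j) * (u (x + -j) - u x) := (Equiv.neg ℤ).summable_iff.2 hLs
  have hLn : ∑' j, k (-j) * (u (x + -j) - u x) = Lop k u x :=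
    (Equiv.neg ℤ).tsum_eq (fun j => k j * (u (x + j) - u x))
  set w : ℤ → ℝ := fun j => -((u (x + j) - u x) + (u (x + -j) - u x)) / 2 with hw
  have hwsum : HasSum (fun j => k j * w j) (-Lop k u x) := by
    have h1 := (hLs.hasSum.add hLsn.hasSum).mul_left (-1/2)
    rw [hLn] at h1
    have ef : (fun j => k j * w j) = fun i => -1 / 2 *
        (k i * (u (x + i) - u x) + k (-i) * (u (x + -i) - u x)) := by
      funext j; simp only [hw, hk.symm j]; ring
    have es : -Lop k u x = -1 / 2 * (∑' b, k b * (u (x + b) - u x) + Lop k u x) := by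
      unfold Lop; ring
    rw [ef, es]
    exact h1
  have hlow : HasSum (fun j => A * (k j * w j) - B * k j - D * k j ^ s)
      (A * (-Lop k u x) - B * (∑' j, k j) - D * (∑' j, k j ^ s)) :=
    ((hwsum.mul_left A).sub (hk.summable.hasSum.mul_left B)).sub (hsum.hasSum.mul_left D)
  have hup : HasSum (fun j => (1/4) * (T (i j) + T (i (-j)))) ((1/4) * (∑' j, T (i j) + ∑' j, T (i j))) := by
    have h1 := (hfs.hasSum.add hfsn.hasSum).mul_left (1/4)
    rw [hneg] at h1
    exact h1
  have key : A * (-Lop k u x) - B * (∑' j, k j) - D * (∑' j, k j ^ s)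
      ≤ (1/4) * (∑' j, T (i j) + ∑' j, T (i j)) := by
    refine hasSum_le (fun j => ?_) hlow hup
    refine (H j (w j)).trans ?_
    have e1 : T (i j) = k j ^ 2 * Real.exp (u (x + -j) - u x) * Ups (2 * w j) := by
      simp only [hT, hi, hw, hk.symm j]
      rw [show x + j + -j = x by ring]
      rw [show u x - u (x + j) - u (x + -j) + u x = 2 * (-((u (x + j) - u x) + (u (x + -j) - u x)) / 2) by ring]
      ring
    have e2 : T (i (-j)) = k j ^ 2 * Real.exp (u (x + j) - u x) * Ups (2 * w j) := by
      simp only [hT, hi, hw, hk.symm j, neg_neg]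
      rw [show x + -j + j = x by ring]
      rw [show u x - u (x + -j) - u (x + j) + u x = 2 * (-((u (x + j) - u x) + (u (x + -j) - u x)) / 2) by ring]
      ring
    have e3 : 2 * Real.exp (-w j) ≤ Real.exp (u (x + -j) - u x) + Real.exp (u (x + j) - u x) := by
      set α := u (x + -j) - u x
      set β := u (x + j) - u x
      have hα : Real.exp α = Real.exp (α / 2) ^ 2 := by rw [← Real.exp_nat_mul]; congr 1; push_cast; ring
      have hβ : Real.exp β = Real.exp (β / 2) ^ 2 := by rw [← Real.exp_nat_mul]; congr 1; push_cast; ring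
      have : Real.exp (-w j) = Real.exp (α / 2) * Real.exp (β / 2) := by
        rw [← Real.exp_add]; congr 1; simp only [hw]; ring
      rw [this, hα, hβ]
      nlinarith [sq_nonneg (Real.exp (α / 2) - Real.exp (β / 2))]
    rw [e1, e2]
    have hU := Ups_nonneg (2 * w j)
    have := mul_le_mul_of_nonneg_left e3 (mul_nonneg (sq_nonneg (k j)) hU)
    unfold Hfun
    linarith
  have : Psi2 k u x = (1/2) * ∑' p, T p := rfl
  rw [this]; linarith

lemma Psi2_pow (k : ℤ → ℝ) (hk : IsKernel k) (τ : ℝ) (hτ0 : 0 < τ) (hτ1 : τ < 1)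
    (hsum : Summable fun j : ℤ => k j ^ (1 - τ)) (hS : 0 < ∑' j, k j ^ (1 - τ)) :
    ∃ a : ℝ, 0 < a ∧ ∀ u, BddFun u → ∀ x, 0 ≤ -Lop k u x →
      a * (-Lop k u x) ^ ((1 + τ) / τ) ≤ Psi2 k u x := by
  set p := (1 + τ) / τ with hp
  have hp1 : p = 1 / τ + 1 := by rw [hp]; field_simp
  have hpi : 1 < 1 / τ := by rw [lt_div_iff₀ hτ0]; linarith
  have hp2 : 2 ≤ p := by linarith
  obtain ⟨a, ha, hH⟩ := Hfun_pow hp2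
  set S := ∑' j, k j ^ (1 - τ)
  refine ⟨a * (1 / S) ^ (1 / τ), by positivity, fun u hu x hr => ?_⟩
  set r := -Lop k u x with hrdef
  set t := r / S with ht
  have ht0 : 0 ≤ t := by positivity
  have main := Psi2_lower k hk (1 - τ) hsum (a * p * t ^ (1 / τ)) 0 (a * (p - 1) * t ^ p) ?_ u hu x
  · refine le_trans (le_of_eq ?_) main
    rw [← hrdef]
    have e1 : t ^ p = t ^ (1 / τ) * t := by
      rw [hp1, Real.rpow_add_of_nonneg ht0 (by positivity) (by norm_num), Real.rpow_one]
    have e2 : r ^ p = r ^ (1 / τ) * r := by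
      rw [hp1, Real.rpow_add_of_nonneg hr (by positivity) (by norm_num), Real.rpow_one]
    have e3 : t ^ (1 / τ) = r ^ (1 / τ) * (1 / S) ^ (1 / τ) := by
      rw [← Real.mul_rpow hr (by positivity)]; congr 1; rw [ht]; ring
    have e4 : t * S = r := by rw [ht]; field_simp
    rw [e1, e2]
    change _ = a * p * t ^ (1 / τ) * r - _ - a * (p - 1) * (t ^ (1 / τ) * t) * S
    rw [e3]
    linear_combination (a * (p - 1) * (r ^ (1 / τ) * (1 / S) ^ (1 / τ))) * e4
  · intro j w
    have hk0 := hk.nonneg j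
    rcases hk0.eq_or_lt with h | hkj
    · rw [← h, Real.zero_rpow (by linarith)]; simp
    have hks : 0 < k j ^ (1 - τ) := Real.rpow_pos_of_pos hkj _
    have htp : 0 ≤ t ^ p := Real.rpow_nonneg ht0 p
    rcases le_or_gt w 0 with hw | hw
    · have h1 := Hfun_nonneg w
      have h2 : 0 ≤ a * p * t ^ (1 / τ) * (k j * (-w)) := by
        have : 0 ≤ -w := by linarith
        positivity
      have h3 : 0 ≤ a * (p - 1) * t ^ p * k j ^ (1 - τ) := by
        have : 0 ≤ p - 1 := by linarith
        positivity
      have h4 : 0 ≤ k j ^ 2 * Hfun w := by positivity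
      nlinarith
    · -- y^p ≥ p s^{p-1} y - (p-1) s^p
      have bern : ∀ s : ℝ, 0 ≤ s → p * (s ^ (1 / τ) * w) - (p - 1) * (s ^ (1 / τ) * s) ≤ w ^ p := by
        intro s hs
        rcases hs.eq_or_lt with h | hs'
        · rw [← h, Real.zero_rpow (by positivity)]
          have := Real.rpow_nonneg hw.le p
          simpa using this
        have hb := one_add_mul_self_le_rpow_one_add (s := w / s - 1)
          (by have : 0 < w / s := by positivity
              linarith) (p := p) (by linarith)
        rw [show 1 + (w / s - 1) = w / s by ring, Real.div_rpow hw.le hs,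
          le_div_iff₀ (Real.rpow_pos_of_pos hs' p)] at hb
        have e : s ^ p = s ^ (1 / τ) * s := by
          rw [hp1, Real.rpow_add_of_nonneg hs (by positivity) (by norm_num), Real.rpow_one]
        rw [e] at hb
        refine le_trans (le_of_eq ?_) hb
        field_simp
        ring
      have hb := bern (t * k j ^ (-τ)) (by positivity)
      have e1 : (t * k j ^ (-τ)) ^ (1 / τ) = t ^ (1 / τ) * (k j)⁻¹ := by
        rw [Real.mul_rpow ht0 (by positivity), ← Real.rpow_mul hk0,
          show -τ * (1 / τ) = -1 by field_simp, Real.rpow_neg_one]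
      have e2 : k j ^ (1 - τ) = k j * k j ^ (-τ) := by
        rw [sub_eq_add_neg, Real.rpow_add hkj, Real.rpow_one]
      have e3 : t ^ p = t ^ (1 / τ) * t := by
        rw [hp1, Real.rpow_add_of_nonneg ht0 (by positivity) (by norm_num), Real.rpow_one]
      rw [e1] at hb
      have h5 := hH w hw.le
      have h6 : k j ^ 2 * (a * (p * (t ^ (1 / τ) * (k j)⁻¹ * w) -
          (p - 1) * (t ^ (1 / τ) * (k j)⁻¹ * (t * k j ^ (-τ))))) ≤ k j ^ 2 * Hfun w := by
        refine mul_le_mul_of_nonneg_left (le_trans ?_ h5) (sq_nonneg _)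
        exact mul_le_mul_of_nonneg_left hb ha.le
      refine le_trans (le_of_eq ?_) h6
      rw [e2, e3]
      field_simp
      ring

lemma Psi2_exp (k : ℤ → ℝ) (hk : IsKernel k) (τ : ℝ) (hτ0 : 0 < τ) (hτ1 : τ < 1)
    (hsum : Summable fun j : ℤ => k j ^ (1 - τ)) (hK : 0 < ∑' j, k j) :
    ∃ b C : ℝ, 0 < b ∧ ∀ u, BddFun u → ∀ x,
      b * Real.exp (-Lop k u x / ∑' j, k j) - C ≤ Psi2 k u x := by
  set K := ∑' j, k j with hKdef
  set S := ∑' j, k j ^ (1 - τ) with hSdef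
  refine ⟨K / 2 * Real.exp (-(S / τ) / K), 3 * K ^ 2 / 2, by positivity, fun u hu x => ?_⟩
  set r := -Lop k u x with hrdef
  set m := (r - S / τ) / K with hm
  have main := Psi2_lower k hk (1 - τ) hsum (Real.exp m / 2)
    (3 * K / 2 - Real.exp m * (1 - m) / 2) (Real.exp m / (2 * τ)) ?_ u hu x
  · refine le_trans (le_of_eq ?_) main
    rw [← hrdef, ← hKdef, ← hSdef, mul_assoc, ← Real.exp_add]
    have e1 : -(S / τ) / K + r / K = m := by rw [hm]; ring
    have e2 : m * K = r - S / τ := by rw [hm]; field_simp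
    rw [e1]
    have e3 : Real.exp m / (2 * τ) * S = Real.exp m / 2 * (S / τ) := by field_simp
    rw [e3]
    linear_combination (Real.exp m / 2) * e2
  · intro j w
    have hk0 := hk.nonneg j
    rcases hk0.eq_or_lt with h | hkj
    · rw [← h, Real.zero_rpow (by linarith)]; simp
    have hkK : k j ≤ K := hk.summable.le_tsum j (fun i _ => hk.nonneg i)
    have e2 : k j ^ (1 - τ) = k j * k j ^ (-τ) := by
      rw [sub_eq_add_neg, Real.rpow_add hkj, Real.rpow_one]
    set y := k j ^ (-τ) with hy
    have hlog : Real.exp (-(y / τ)) ≤ k j := by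
      rw [← Real.le_log_iff_exp_le hkj]
      have h1 := Real.log_le_self (x := y) (by positivity)
      rw [hy, Real.log_rpow hkj, ← hy] at h1
      have : -(y / τ) * τ = - y := by field_simp
      nlinarith
    have h1 : Real.exp m * (1 + (w - y / τ - m)) ≤ k j * Real.exp w := by
      have h2 := Real.add_one_le_exp (w - y / τ - m)
      calc _ ≤ Real.exp m * Real.exp (w - y / τ - m) := by gcongr; linarith
        _ = Real.exp (-(y / τ)) * Real.exp w := by
          rw [← Real.exp_add, ← Real.exp_add]; congr 1; ring
        _ ≤ _ := by gcongr
    have h3 := mul_le_mul_of_nonneg_left (Hfun_exp w) (sq_nonneg (k j))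
    have h4 := mul_le_mul_of_nonneg_left h1 hk0
    have h5 := mul_le_mul_of_nonneg_left hkK hk0
    rw [e2]
    have e4 : Real.exp m / (2 * τ) * (k j * y) = Real.exp m * k j * (y / τ) / 2 := by field_simp
    rw [e4]
    nlinarith

lemma gfun_strictConvex {q p : ℝ} (hq : 0 < q) (hp : 1 < p) :
    StrictConvexOn ℝ (Ici 0) (fun r : ℝ => (Real.exp (q * r) - 1) ^ p) := by
  have hge : ∀ r : ℝ, 0 ≤ r → 0 ≤ Real.exp (q * r) - 1 := fun r hr => by
    have := Real.one_le_exp (x := q * r) (by positivity)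
    linarith
  refine ⟨convex_Ici 0, fun x hx y hy hxy a b ha hb hab => ?_⟩
  have hx' : 0 ≤ x := hx
  have hy' : 0 ≤ y := hy
  have h1 := strictConvexOn_exp.2 (mem_univ (q * x)) (mem_univ (q * y))
    (fun h => hxy (mul_left_cancel₀ hq.ne' h)) ha hb hab
  have h2 := (convexOn_rpow hp.le).2 (hge x hx') (hge y hy') ha.le hb.le hab
  simp only [smul_eq_mul] at *
  refine lt_of_lt_of_le ?_ h2
  apply Real.rpow_lt_rpow (hge _ (by positivity)) _ (by linarith)
  rw [show q * (a * x + b * y) = a * (q * x) + b * (q * y) by ring]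
  nlinarith

/-- Corollary (combined asymptotics): if `∑_j k(j)^{1−τ} < ∞` for some `τ ∈ (0,1)`, then the
generated operator satisfies `CD_Υ(0,F)` with a strictly convex CD-function `F` such that
`F(r) ∼ c₁ e^{r/|k|₁}` as `r → ∞` and `F(r) ∼ c₂ r^{(1+τ)/τ}` as `r → 0+`. -/
theorem combined_asymptotics (k : ℤ → ℝ) (hk : IsKernel k) (τ : ℝ)
    (hτ0 : 0 < τ) (hτ1 : τ < 1)
    (hsum : Summable fun j : ℤ => k j ^ (1 - τ)) :
    ∃ c₁ c₂ : ℝ, 0 < c₁ ∧ 0 < c₂ ∧ ∃ F : ℝ → ℝ,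
      IsCDFunction F ∧ StrictConvexOn ℝ (Ici 0) F ∧ CDUps k F ∧
      Tendsto (fun r => F r / (c₁ * Real.exp (r / ∑' j : ℤ, k j))) atTop (nhds 1) ∧
      Tendsto (fun r => F r / (c₂ * r ^ ((1 + τ) / τ))) (nhdsWithin 0 (Ioi 0)) (nhds 1) := by
  obtain ⟨j₀, hj₀⟩ := hk.nontrivial
  have hj0 : 0 < k j₀ := lt_of_le_of_ne (hk.nonneg j₀) (Ne.symm hj₀)
  have hK : 0 < ∑' j, k j := hk.summable.tsum_pos hk.nonneg j₀ hj0
  have hS : 0 < ∑' j, k j ^ (1 - τ) :=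
    hsum.tsum_pos (fun j => Real.rpow_nonneg (hk.nonneg j) _) j₀ (Real.rpow_pos_of_pos hj0 _)
  obtain ⟨a, ha, hpow⟩ := Psi2_pow k hk τ hτ0 hτ1 hsum hS
  obtain ⟨b, C, hb, hexp⟩ := Psi2_exp k hk τ hτ0 hτ1 hsum hK
  set K := ∑' j, k j with hKdef
  set p := (1 + τ) / τ with hp
  have hp1 : 1 < p := by rw [hp, lt_div_iff₀ hτ0]; linarith
  have hp0 : 0 < p := by linarith
  set q := 1 / (K * p) with hq
  have hq0 : 0 < q := by positivity
  have hqp : ∀ r, q * r * p = r / K := fun r => by rw [hq]; field_simp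
  -- threshold
  obtain ⟨R, hR0, hR⟩ : ∃ R : ℝ, 0 < R ∧ ∀ r, R ≤ r → b / 2 * Real.exp (r / K) ≤ b * Real.exp (r / K) - C := by
    refine ⟨K * (2 * |C| / b + 1), by positivity, fun r hr => ?_⟩
    have h1 : 2 * |C| / b + 1 ≤ r / K := by rw [le_div_iff₀ hK]; linarith
    have h2 := Real.add_one_le_exp (r / K)
    have h3 : 2 * |C| / b ≤ Real.exp (r / K) := by linarith
    rw [div_le_iff₀ hb] at h3
    have := le_abs_self C
    linarith
  set D := q ^ p * Real.exp (R / K) with hD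
  have hD0 : 0 < D := by positivity
  set c := min (b / 2) (a / D) with hc
  have hc0 : 0 < c := by positivity
  have hge : ∀ r : ℝ, 0 ≤ r → 0 ≤ Real.exp (q * r) - 1 := fun r hr => by
    have := Real.one_le_exp (x := q * r) (by positivity)
    linarith
  set F : ℝ → ℝ := fun r => c * (Real.exp (q * r) - 1) ^ p with hF
  have hF0 : F 0 = 0 := by simp [hF, Real.zero_rpow hp0.ne']
  have hFpos : ∀ r, 0 < r → 0 < F r := fun r hr => by
    have : 0 < Real.exp (q * r) - 1 := by
      have := Real.one_lt_exp_iff.2 (show 0 < q * r by positivity)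
      linarith
    simp only [hF]; positivity
  have hcont : Continuous F := by
    simp only [hF]
    exact continuous_const.mul ((by fun_prop : Continuous fun r : ℝ => Real.exp (q * r) - 1).rpow_const
      (fun _ => Or.inr hp0.le))
  have hconv : StrictConvexOn ℝ (Ici 0) F := by
    have h := gfun_strictConvex hq0 hp1
    refine ⟨convex_Ici 0, fun x hx y hy hxy s t hs ht hst => ?_⟩
    have := mul_lt_mul_of_pos_left (h.2 hx hy hxy hs ht hst) hc0
    simp only [smul_eq_mul, hF] at *
    linarith
  have hinf : Tendsto (fun r => F r / (c * Real.exp (r / K))) atTop (nhds 1) := by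
    have h1 : Tendsto (fun r : ℝ => (1 - Real.exp (-(q * r))) ^ p) atTop (nhds 1) := by
      have h2 : Tendsto (fun r : ℝ => Real.exp (-(q * r))) atTop (nhds 0) :=
        Real.tendsto_exp_neg_atTop_nhds_zero.comp (tendsto_id.const_mul_atTop hq0)
      have h3 : Tendsto (fun r : ℝ => 1 - Real.exp (-(q * r))) atTop (nhds 1) := by
        simpa using h2.const_sub 1
      simpa using h3.rpow_const (p := p) (Or.inl one_ne_zero)
    refine h1.congr' ?_
    filter_upwards [eventually_ge_atTop 0] with r hr
    have e1 : Real.exp (r / K) = Real.exp (q * r) ^ p := by rw [← Real.exp_mul, hqp]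
    simp only [hF]
    rw [e1, mul_div_mul_left _ _ hc0.ne', ← Real.div_rpow (hge r hr) (Real.exp_pos _).le, Real.exp_neg]
    congr 1
    field_simp
  have hzero : Tendsto (fun r => F r / (c * q ^ p * r ^ p)) (nhdsWithin 0 (Ioi 0)) (nhds 1) := by
    have h1 : Tendsto (fun r : ℝ => (Real.exp (q * r) - 1) / (q * r)) (nhdsWithin 0 (Ioi 0)) (nhds 1) := by
      have hd : HasDerivAt (fun r : ℝ => Real.exp (q * r)) q 0 := by
        have := ((hasDerivAt_id (0:ℝ)).const_mul q).exp
        simpa using this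
      have h2 := hd.tendsto_slope_zero_right
      have h3 := h2.div_const q
      rw [div_self hq0.ne'] at h3
      refine h3.congr (fun r => ?_)
      simp only [zero_add, mul_zero, Real.exp_zero, smul_eq_mul]
      rw [mul_comm q r, ← div_div]
      ring
    have h4 : Tendsto (fun r : ℝ => ((Real.exp (q * r) - 1) / (q * r)) ^ p) (nhdsWithin 0 (Ioi 0)) (nhds 1) := by
      simpa using h1.rpow_const (p := p) (Or.inl one_ne_zero)
    refine h4.congr' ?_
    filter_upwards [self_mem_nhdsWithin] with r hr
    have hr' : 0 < r := hr
    simp only [hF]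
    rw [mul_assoc, mul_div_mul_left _ _ hc0.ne', Real.div_rpow (hge r hr'.le) (by positivity),
      Real.mul_rpow hq0.le hr'.le]
  refine ⟨c, c * q ^ p, hc0, by positivity, F, ⟨hcont.continuousOn, ?_, hF0, ?_, 1, one_pos, ?_⟩,
    hconv, ?_, hinf, hzero⟩
  · intro r hr
    rcases hr.eq_or_lt with h | h
    · rw [← h, hF0]
    · exact (hFpos r h).le
  · intro x hx y hy hxy
    have hx' : 0 < x := hx
    have hy' : 0 < y := hy
    have h := hconv.2 (mem_Ici.2 hy'.le) (mem_Ici.2 (le_refl (0:ℝ))) hy'.ne'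
      (show 0 < x / y by positivity) (show 0 < 1 - x / y by
        have : x / y < 1 := by rw [div_lt_one hy']; exact hxy
        linarith) (by ring)
    simp only [smul_eq_mul, hF0, mul_zero, add_zero] at h
    rw [div_mul_cancel₀ _ hy'.ne'] at h
    change F x / x < F y / y
    rw [div_lt_iff₀ hx']
    calc _ < _ := h
      _ = _ := by ring
  · rw [integrableOn_Ici_iff_integrableOn_Ioi]
    refine integrable_of_isBigO_exp_neg (b := 1 / K) (by positivity) ?_ ?_
    · exact continuousOn_const.div hcont.continuousOn
        (fun r hr => (hFpos r (lt_of_lt_of_le one_pos hr)).ne')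
    · have h1 : Tendsto (fun r => (1 / F r) / Real.exp (-(1 / K) * r)) atTop (nhds (1 / c)) := by
        have h2 := (hinf.inv₀ one_ne_zero).div_const c
        rw [inv_one] at h2
        refine h2.congr (fun r => ?_)
        rw [show -(1 / K) * r = -(r / K) by ring, Real.exp_neg]
        field_simp
      exact Asymptotics.isBigO_of_div_tendsto_nhds
        (Eventually.of_forall fun r h => absurd h (Real.exp_pos _).ne') _ h1
  · intro u hu x hr
    have h1 := hpow u hu x hr
    have h2 := hexp u hu x
    set r := -Lop k u x
    rcases le_total R r with h | h
    · refine le_trans ?_ ((hR r h).trans h2)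
      have e1 : Real.exp (r / K) = Real.exp (q * r) ^ p := by rw [← Real.exp_mul, hqp]
      rw [e1]
      simp only [hF]
      have := hge r hr
      gcongr
      · exact min_le_left _ _
      · linarith
    · refine le_trans ?_ h1
      have h3 : Real.exp (q * r) - 1 ≤ q * r * Real.exp (q * r) := by
        have h4 := Real.add_one_le_exp (-(q * r))
        have h5 : Real.exp (-(q * r)) * Real.exp (q * r) = 1 := by rw [← Real.exp_add]; simp
        nlinarith [Real.exp_pos (q * r)]
      have := hge r hr
      calc F r ≤ a / D * (q * r * Real.exp (q * r)) ^ p := by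
            simp only [hF]; gcongr; exact min_le_right _ _
        _ = a / D * (q ^ p * r ^ p * Real.exp (r / K)) := by
            rw [Real.mul_rpow (by positivity) (Real.exp_pos _).le, Real.mul_rpow hq0.le hr,
              ← Real.exp_mul, hqp]
        _ ≤ a / D * (q ^ p * r ^ p * Real.exp (R / K)) := by gcongr
        _ = a * r ^ p := by rw [hD]; field_simp
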